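/- Let μ_{k,n−k} be the uniform probability measure on the slice X_{k,n−k} of the discrete cube. Then for all probability measures ν₁, ν₂ on X_{k,n−k}, T̃₂(ν₂|ν₁) ≤ 2 C_{k,n−k} · ( √H(ν₁|μ_{k,n−k}) + √H(ν₂|μ_{k,n−k}) )², where C_{k,n−k} = min(k, n−k) and T̃₂ is the weak transport cost for the Hamming distance d_h. -/

import Mathlib

attribute [local instance] Classical.propDecidable

noncomputable section

/-- The cubeSlice `X_{k, n-k}` of the discrete cube `{0,1}^n`. -/
def cubeSlice (n k : ℕ) : Set (Fin n → Bool) :=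
  {x | (Finset.univ.filter fun i => x i = true).card = k}

/-- The uniform probability measure on the cubeSlice `X_{k, n-k}`. -/
noncomputable def unifSlice (n k : ℕ) : (Fin n → Bool) → ℝ :=
  fun x => if x ∈ cubeSlice n k then ((n.choose k : ℝ))⁻¹ else 0

/-- The Hamming distance on the cubeSlice of the discrete cube. -/
noncomputable def dh {n : ℕ} (x y : Fin n → Bool) : ℝ :=
  ((Finset.univ.filter fun i => x i ≠ y i).card : ℝ) / 2

/-- Relative entropy `H(ν | μ)` of finitely supported densities; `+∞` if `ν` is not
absolutely continuous with respect to `μ`. -/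
noncomputable def relEnt {X : Type*} [Fintype X] (ν μ : X → ℝ) : ENNReal :=
  if ∀ x, μ x = 0 → ν x = 0 then
    ENNReal.ofReal (∑ x, ν x * Real.log (ν x / μ x))
  else ⊤

/-- `p` is a probability measure supported on the set `S`. -/
def IsProbOn {X : Type*} [Fintype X] (p : X → ℝ) (S : Set X) : Prop :=
  (∀ x, 0 ≤ p x) ∧ (∀ x, x ∉ S → p x = 0) ∧ ∑ x, p x = 1

/-- The weak transport cost `̃T₂(ν₂ | ν₁)` for the cost `d` (kernel formulation,
`π(x, y) = ν₁(x) p_x(y)`). -/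
noncomputable def tT2 {X : Type*} [Fintype X] (d : X → X → ℝ) (ν₁ ν₂ : X → ℝ) : ℝ :=
  sInf {w | ∃ p : X → X → ℝ,
    (∀ x y, 0 ≤ p x y) ∧ (∀ x, ∑ y, p x y = 1) ∧ (∀ y, ∑ x, ν₁ x * p x y = ν₂ y) ∧
    w = ∑ x, ν₁ x * (∑ y, p x y * d x y) ^ 2}

/-- The relative entropy of a density `ν` with respect to the uniform measure on `N` points. -/
def unifEnt {X : Type*} [Fintype X] (N : ℕ) (ν : X → ℝ) : ℝ :=
  ∑ x, ν x * Real.log (ν x) + Real.log N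

/-- Some Markov kernel transports `ν₁` to `ν₂` at weak quadratic cost at most `c`. -/
def HasTransport {X : Type*} [Fintype X] (d : X → X → ℝ) (ν₁ ν₂ : X → ℝ) (c : ℝ) : Prop :=
  ∃ p : X → X → ℝ, (∀ x y, 0 ≤ p x y) ∧ (∀ x, ∑ y, p x y = 1) ∧
    (∀ y, ∑ x, ν₁ x * p x y = ν₂ y) ∧ ∑ x, ν₁ x * (∑ y, p x y * d x y) ^ 2 ≤ c

/-- The weak transport-entropy inequality for the uniform measure on `S`. -/
def WeakTransportEntropy {X : Type*} [Fintype X] (S : Set X) (d : X → X → ℝ) (C : ℝ) : Prop :=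
  ∀ ν₁ ν₂ : X → ℝ, IsProbOn ν₁ S → IsProbOn ν₂ S →
    HasTransport d ν₁ ν₂ (2 * C * (√(unifEnt S.ncard ν₁) + √(unifEnt S.ncard ν₂)) ^ 2)

lemma sum_mul_sqrt_add_sqrt_sq_le {ι : Type*} (s : Finset ι) {w a b : ι → ℝ}
    (hw : ∀ i, 0 ≤ w i) (ha : ∀ i, 0 ≤ a i) (hb : ∀ i, 0 ≤ b i) :
    ∑ i ∈ s, w i * (√(a i) + √(b i)) ^ 2 ≤
      (√(∑ i ∈ s, w i * a i) + √(∑ i ∈ s, w i * b i)) ^ 2 := by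
  have hA : 0 ≤ ∑ i ∈ s, w i * a i := Finset.sum_nonneg fun i _ => mul_nonneg (hw i) (ha i)
  have hB : 0 ≤ ∑ i ∈ s, w i * b i := Finset.sum_nonneg fun i _ => mul_nonneg (hw i) (hb i)
  have hcs := Real.sum_sqrt_mul_sqrt_le s (fun i => mul_nonneg (hw i) (ha i))
    (fun i => mul_nonneg (hw i) (hb i))
  have hexp : ∑ i ∈ s, w i * (√(a i) + √(b i)) ^ 2 =
      ∑ i ∈ s, w i * a i + ∑ i ∈ s, w i * b i + 2 * ∑ i ∈ s, √(w i * a i) * √(w i * b i) := by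
    rw [Finset.mul_sum, ← Finset.sum_add_distrib, ← Finset.sum_add_distrib]
    refine Finset.sum_congr rfl fun i _ => ?_
    rw [Real.sqrt_mul (hw i), Real.sqrt_mul (hw i)]
    have h1 := Real.mul_self_sqrt (hw i)
    have h2 := Real.sq_sqrt (ha i)
    have h3 := Real.sq_sqrt (hb i)
    calc _ = w i * √(a i) ^ 2 + w i * √(b i) ^ 2 + 2 * (w i * √(a i) * √(b i)) := by ring
      _ = w i * a i + w i * b i + 2 * (√(w i) * √(w i) * √(a i) * √(b i)) := by rw [h1, h2, h3]
      _ = _ := by ring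
  rw [hexp, add_sq, Real.sq_sqrt hA, Real.sq_sqrt hB]
  linarith

lemma sqrt_add_sqrt_sq_add_le {a₁ a₂ b₁ b₂ : ℝ} (ha₁ : 0 ≤ a₁) (ha₂ : 0 ≤ a₂) (hb₁ : 0 ≤ b₁)
    (hb₂ : 0 ≤ b₂) :
    (√a₁ + √b₁) ^ 2 + (√a₂ + √b₂) ^ 2 ≤ (√(a₁ + a₂) + √(b₁ + b₂)) ^ 2 := by
  have h := sum_mul_sqrt_add_sqrt_sq_le (Finset.univ : Finset (Fin 2)) (w := fun _ => 1)
    (a := ![a₁, a₂]) (b := ![b₁, b₂]) (fun _ => zero_le_one)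
    (by intro i; fin_cases i <;> simpa) (by intro i; fin_cases i <;> simpa)
  simpa [Fin.sum_univ_two] using h

/-- Jensen's inequality for the square and subprobability weights. -/
lemma sq_sum_mul_le {ι : Type*} (s : Finset ι) {p f : ι → ℝ} (hp : ∀ i, 0 ≤ p i)
    (h1 : ∑ i ∈ s, p i ≤ 1) : (∑ i ∈ s, p i * f i) ^ 2 ≤ ∑ i ∈ s, p i * f i ^ 2 := by
  have h := Finset.sum_sq_le_sum_mul_sum_of_sq_le_mul s (r := fun i => p i * f i) (f := p)
    (g := fun i => p i * f i ^ 2) (fun i _ => hp i) (fun i _ => mul_nonneg (hp i) (sq_nonneg _))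
    (fun i _ => le_of_eq (by ring))
  exact h.trans (mul_le_of_le_one_left
    (Finset.sum_nonneg fun i _ => mul_nonneg (hp i) (sq_nonneg _)) h1)

open InformationTheory in
lemma sq_sub_one_le_mul_klFun {f : ℝ} (hf : 1 ≤ f) : (f - 1) ^ 2 ≤ f * (2 * klFun f) := by
  have h := Real.le_log_one_add_of_nonneg (x := f - 1) (by linarith)
  rw [add_sub_cancel, div_le_iff₀ (by linarith)] at h
  rw [klFun]
  have h2 : (f - 1) ^ 2 ≤ (f + 1) * (f * Real.log f + 1 - f) := by nlinarith
  have h3 : 0 ≤ f * Real.log f + 1 - f := klFun_nonneg (by linarith)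
  nlinarith

open InformationTheory in
lemma one_sub_sq_le_klFun {f : ℝ} (h0 : 0 ≤ f) (hf : f ≤ 1) : (1 - f) ^ 2 ≤ 2 * klFun f := by
  rw [klFun]
  rcases h0.eq_or_lt with rfl | h
  · norm_num
  · have h1 := Real.sinh_le_self_iff.2 (Real.log_nonpos h0 hf)
    rw [Real.sinh_log h] at h1
    have h2 := mul_le_mul_of_nonneg_left h1 h0
    have h3 : f * ((f - f⁻¹) / 2) = (f ^ 2 - 1) / 2 := by field_simp
    nlinarith

open InformationTheory in
/-- The pointwise estimate behind the transport inequality for the trivial metric. -/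
lemma sq_max_sub_div_le {f g : ℝ} (hf : 0 ≤ f) (hg : 0 ≤ g) :
    max (f - g) 0 ^ 2 / f ≤ 2 * (√(klFun f) + √(klFun g)) ^ 2 := by
  have hF := klFun_nonneg hf
  have hG := klFun_nonneg hg
  rcases hf.eq_or_lt with rfl | hf'
  · rw [div_zero]; positivity
  rw [div_le_iff₀ hf']
  have sF := Real.sqrt_nonneg (klFun f)
  have sG := Real.sqrt_nonneg (klFun g)
  have qF := Real.sq_sqrt hF
  have qG := Real.sq_sqrt hG
  rcases le_total f g with hfg | hfg
  · rw [max_eq_right (by linarith), zero_pow two_ne_zero]; positivity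
  rw [max_eq_left (by linarith)]
  rcases le_total f 1 with h1 | h1
  · have h := one_sub_sq_le_klFun hg (hfg.trans h1)
    have h2 : (f - g) ^ 2 ≤ (1 - g) ^ 2 * f := by
      nlinarith [mul_nonneg (sub_nonneg.2 h1) (sub_nonneg.2 (pow_le_pow_left₀ hg hfg 2)),
        mul_nonneg (sub_nonneg.2 h1) (mul_nonneg hf (sub_nonneg.2 h1)),
        mul_nonneg (sub_nonneg.2 h1) (sub_nonneg.2 hfg), mul_nonneg hf (sub_nonneg.2 hfg),
        mul_nonneg hf hg, mul_nonneg (sub_nonneg.2 h1) hg]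
    nlinarith [mul_nonneg sF sG, mul_le_mul_of_nonneg_right h hf]
  · have h := sq_sub_one_le_mul_klFun h1
    rcases le_total g 1 with h2 | h2
    · have h3 := one_sub_sq_le_klFun hg h2
      have e1 : f - 1 ≤ √(f * (2 * klFun f)) := Real.le_sqrt_of_sq_le h
      have e2 : 1 - g ≤ √(f * (2 * klFun g)) := Real.le_sqrt_of_sq_le (by nlinarith)
      have e3 : f - g ≤ √(f * 2) * (√(klFun f) + √(klFun g)) := by
        rw [mul_add, ← Real.sqrt_mul (by positivity), ← Real.sqrt_mul (by positivity), mul_assoc,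
          mul_assoc]
        linarith
      calc (f - g) ^ 2 ≤ (√(f * 2) * (√(klFun f) + √(klFun g))) ^ 2 := by
            gcongr
        _ = _ := by rw [mul_pow, Real.sq_sqrt (by positivity)]; ring
    · have : (f - g) ^ 2 ≤ (f - 1) ^ 2 := by gcongr
      nlinarith [mul_nonneg (mul_nonneg sF sG) hf, mul_nonneg hf hG]

section Entropy
variable {X : Type*} [Fintype X]

open InformationTheory in
lemma sum_klFun_eq_unifEnt [Nonempty X] {ν : X → ℝ} (hν : ∑ x, ν x = 1) :
    ∑ x, (Fintype.card X : ℝ)⁻¹ * klFun (Fintype.card X * ν x) =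
      unifEnt (Fintype.card X) ν := by
  have hN : (Fintype.card X : ℝ) ≠ 0 := by simp
  have h : ∀ x, (Fintype.card X : ℝ)⁻¹ * klFun (Fintype.card X * ν x) =
      ν x * Real.log (ν x) + ν x * Real.log (Fintype.card X) + (Fintype.card X : ℝ)⁻¹ - ν x := by
    intro x
    rw [klFun]
    rcases eq_or_ne (ν x) 0 with h0 | h0
    · simp [h0]
    · rw [Real.log_mul hN h0]
      field_simp
      ring
  simp_rw [h, unifEnt]
  rw [Finset.sum_sub_distrib, Finset.sum_add_distrib, Finset.sum_add_distrib, ← Finset.sum_mul, hν]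
  simp

lemma unifEnt_card_nonneg [Nonempty X] {ν : X → ℝ} (h0 : ∀ x, 0 ≤ ν x) (hν : ∑ x, ν x = 1) :
    0 ≤ unifEnt (Fintype.card X) ν := by
  rw [← sum_klFun_eq_unifEnt hν]
  exact Finset.sum_nonneg fun x _ => mul_nonneg (by positivity)
    (InformationTheory.klFun_nonneg (mul_nonneg (by positivity) (h0 x)))

open InformationTheory in
lemma sum_sq_max_sub_div_le [Nonempty X] {ν₁ ν₂ : X → ℝ} (h1 : ∀ x, 0 ≤ ν₁ x)
    (h2 : ∀ x, 0 ≤ ν₂ x) (s1 : ∑ x, ν₁ x = 1) (s2 : ∑ x, ν₂ x = 1) :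
    ∑ x, max (ν₁ x - ν₂ x) 0 ^ 2 / ν₁ x ≤
      2 * (√(unifEnt (Fintype.card X) ν₁) + √(unifEnt (Fintype.card X) ν₂)) ^ 2 := by
  set N : ℝ := (Fintype.card X : ℝ) with hN
  have hN0 : 0 < N := by simp [hN, Fintype.card_pos]
  rw [← sum_klFun_eq_unifEnt s1, ← sum_klFun_eq_unifEnt s2, ← hN]
  refine le_trans ?_ (mul_le_mul_of_nonneg_left (sum_mul_sqrt_add_sqrt_sq_le Finset.univ
    (fun _ => (inv_pos.2 hN0).le) (fun x => klFun_nonneg (mul_nonneg hN0.le (h1 x)))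
    (fun x => klFun_nonneg (mul_nonneg hN0.le (h2 x)))) zero_le_two)
  rw [Finset.mul_sum]
  refine Finset.sum_le_sum fun x _ => ?_
  have h := mul_le_mul_of_nonneg_left (sq_max_sub_div_le (mul_nonneg hN0.le (h1 x))
    (mul_nonneg hN0.le (h2 x))) (inv_pos.2 hN0).le
  have e : max (N * ν₁ x - N * ν₂ x) 0 = N * max (ν₁ x - ν₂ x) 0 := by
    rw [← mul_sub, mul_max_of_nonneg _ _ hN0.le, mul_zero]
  rw [e] at h
  have e2 : N⁻¹ * ((N * max (ν₁ x - ν₂ x) 0) ^ 2 / (N * ν₁ x)) =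
      max (ν₁ x - ν₂ x) 0 ^ 2 / ν₁ x := by
    rcases eq_or_ne (ν₁ x) 0 with h0 | h0
    · simp [h0]
    · field_simp
  rw [e2] at h
  linarith

/-- The weak transport-entropy inequality for the trivial metric. -/
lemma weakTransportEntropy_trivial [Nonempty X] :
    WeakTransportEntropy (Set.univ : Set X) (fun x y => if x = y then 0 else 1) 1 := by
  rintro ν₁ ν₂ ⟨n1, -, s1⟩ ⟨n2, -, s2⟩
  rw [Set.ncard_univ, Nat.card_eq_fintype_card, mul_one]
  set a : X → ℝ := fun x => max (ν₁ x - ν₂ x) 0 with ha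
  set b : X → ℝ := fun x => max (ν₂ x - ν₁ x) 0 with hb
  have a0 : ∀ x, 0 ≤ a x := fun x => le_max_right _ _
  have b0 : ∀ x, 0 ≤ b x := fun x => le_max_right _ _
  have hab : ∀ x, a x - b x = ν₁ x - ν₂ x := by
    intro x
    rcases le_total (ν₁ x) (ν₂ x) with h | h
    · simp [ha, hb, h]
    · simp [ha, hb, h]
  have aν : ∀ x, a x ≤ ν₁ x := fun x => max_le (by linarith [n2 x]) (n1 x)
  have sab : ∑ x, a x = ∑ x, b x := by
    rw [← sub_eq_zero, ← Finset.sum_sub_distrib]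
    simp_rw [hab]
    rw [Finset.sum_sub_distrib, s1, s2, sub_self]
  set Δ := ∑ x, b x with hΔ
  have Δ0 : 0 ≤ Δ := Finset.sum_nonneg fun x _ => b0 x
  have aΔ : ∀ x, a x * Δ / Δ = a x := by
    intro x
    rcases eq_or_ne Δ 0 with h | h
    · have := (Finset.sum_eq_zero_iff_of_nonneg fun x _ => a0 x).1 (sab.trans h) x
        (Finset.mem_univ x)
      simp [this]
    · field_simp
  have bΔ : ∀ x, Δ * b x / Δ = b x := by
    intro x
    rcases eq_or_ne Δ 0 with h | h
    · have := (Finset.sum_eq_zero_iff_of_nonneg fun x _ => b0 x).1 h x (Finset.mem_univ x)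
      simp [this]
    · field_simp
  refine ⟨fun x y => if ν₁ x = 0 then (if x = y then 1 else 0) else
    ((if x = y then ν₁ x - a x else 0) + a x * b y / Δ) / ν₁ x, ?_, ?_, ?_, ?_⟩
  · intro x y
    have := sub_nonneg.2 (aν x)
    have := n1 x
    have := a0 x
    have := b0 y
    dsimp only
    split_ifs <;> positivity
  · intro x
    by_cases h : ν₁ x = 0
    · simp [h]
    · simp only [h, if_false]
      rw [← Finset.sum_div, Finset.sum_add_distrib, ← Finset.sum_div, ← Finset.mul_sum, ← hΔ, aΔ]
      simp [h]
  · intro y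
    have : ∀ x, ν₁ x * (if ν₁ x = 0 then (if x = y then (1 : ℝ) else 0) else
        ((if x = y then ν₁ x - a x else 0) + a x * b y / Δ) / ν₁ x) =
        (if x = y then ν₁ x - a x else 0) + a x * b y / Δ := by
      intro x
      by_cases h : ν₁ x = 0
      · have : a x = 0 := le_antisymm (h ▸ aν x) (a0 x)
        simp [h, this]
      · simp only [h, if_false]
        field_simp
    simp_rw [this]
    rw [Finset.sum_add_distrib, ← Finset.sum_div, ← Finset.sum_mul, sab, bΔ]
    simp
    linarith [hab y]
  · refine le_trans (Finset.sum_le_sum fun x _ => ?_) (sum_sq_max_sub_div_le n1 n2 s1 s2)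
    by_cases h : ν₁ x = 0
    · simp [h]
    · have hpos : 0 < ν₁ x := lt_of_le_of_ne (n1 x) (Ne.symm h)
      simp only [h, if_false]
      have hle : ∑ y, ((if x = y then ν₁ x - a x else 0) + a x * b y / Δ) / ν₁ x *
          (if x = y then 0 else 1) ≤ a x / ν₁ x := by
        conv_rhs => rw [← aΔ x, hΔ, Finset.mul_sum, Finset.sum_div, Finset.sum_div, ← hΔ]
        refine Finset.sum_le_sum fun y _ => ?_
        have := a0 x
        have := b0 y
        by_cases hxy : x = y
        · simp only [hxy, if_true, mul_zero]
          have := a0 y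
          have := n1 y
          positivity
        · simp [hxy]
      calc _ ≤ ν₁ x * (a x / ν₁ x) ^ 2 := by
            refine mul_le_mul_of_nonneg_left (pow_le_pow_left₀ ?_ hle 2) (n1 x)
            refine Finset.sum_nonneg fun y _ => mul_nonneg (div_nonneg ?_ (n1 x)) ?_
            · have := sub_nonneg.2 (aν x)
              have := a0 x
              have := b0 y
              split_ifs <;> positivity
            · split_ifs <;> norm_num
        _ = _ := by field_simp; rfl

end Entropy

section Product
variable {I Y : Type*} [Fintype I] [Fintype Y]

lemma unifEnt_prod [Nonempty I] [Nonempty Y] {ν : I → ℝ} {c : I → Y → ℝ} (hν : ∑ i, ν i = 1)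
    (hc : ∀ i, ∑ y, c i y = 1) :
    unifEnt (Fintype.card (I × Y)) (fun z : I × Y => ν z.1 * c z.1 z.2) =
      unifEnt (Fintype.card I) ν + ∑ i, ν i * unifEnt (Fintype.card Y) (c i) := by
  have h : ∀ i y, ν i * c i y * Real.log (ν i * c i y) =
      c i y * (ν i * Real.log (ν i)) + ν i * (c i y * Real.log (c i y)) := by
    intro i y
    rcases eq_or_ne (ν i) 0 with h0 | h0
    · simp [h0]
    rcases eq_or_ne (c i y) 0 with h1 | h1
    · simp [h1]
    rw [Real.log_mul h0 h1]
    ring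
  simp only [unifEnt, Fintype.card_prod, Nat.cast_mul, Fintype.sum_prod_type, h,
    Finset.sum_add_distrib, ← Finset.sum_mul, ← Finset.mul_sum, hc, one_mul, mul_add, hν]
  rw [Real.log_mul (by simp) (by simp)]
  ring

lemma exists_disintegration [Nonempty Y] {w : I × Y → ℝ} (h0 : ∀ z, 0 ≤ w z) :
    ∃ (ν : I → ℝ) (c : I → Y → ℝ), (∀ i, 0 ≤ ν i) ∧ ∑ i, ν i = ∑ z, w z ∧
      (∀ i y, 0 ≤ c i y) ∧ (∀ i, ∑ y, c i y = 1) ∧ w = fun z => ν z.1 * c z.1 z.2 := by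
  have hν : ∀ i, 0 ≤ ∑ y, w (i, y) := fun i => Finset.sum_nonneg fun y _ => h0 _
  refine ⟨fun i => ∑ y, w (i, y), fun i y => if ∑ y, w (i, y) = 0 then (Fintype.card Y : ℝ)⁻¹
    else w (i, y) / ∑ y, w (i, y), hν, (Fintype.sum_prod_type w).symm, ?_, ?_, ?_⟩
  · intro i y
    dsimp only
    split_ifs
    · positivity
    · exact div_nonneg (h0 _) (hν i)
  · intro i
    by_cases h : ∑ y, w (i, y) = 0
    · simp [h]
    · simp only [h, if_false]
      rw [← Finset.sum_div, div_self h]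
  · ext ⟨i, y⟩
    by_cases h : ∑ y, w (i, y) = 0
    · simpa [h] using (Finset.sum_eq_zero_iff_of_nonneg fun y _ => h0 (i, y)).1 h y
    · simp only [h, if_false]
      field_simp

lemma unifEnt_comp_equiv (σ : Equiv.Perm Y) {ν : Y → ℝ} (N : ℕ) :
    unifEnt N (fun y => ν (σ y)) = unifEnt N ν := by
  rw [unifEnt, unifEnt, Equiv.sum_comp σ fun y => ν y * Real.log (ν y)]

/-- A second moment estimate for a sum, combining Minkowski and Cauchy-Schwarz. -/
lemma sum_mul_add_sq_le {ι : Type*} (s : Finset ι) {w u v : ι → ℝ} {A B C : ℝ}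
    (hw : ∀ i, 0 ≤ w i) (hu : ∀ i, 0 ≤ u i) (hv : ∀ i, 0 ≤ v i) (hC : 0 ≤ C) (hA : 0 ≤ A)
    (hB : 0 ≤ B) (huA : ∑ i ∈ s, w i * u i ^ 2 ≤ A) (hvB : ∑ i ∈ s, w i * v i ^ 2 ≤ C * B) :
    ∑ i ∈ s, w i * (u i + v i) ^ 2 ≤ (C + 1) * (A + B) := by
  have h := sum_mul_sqrt_add_sqrt_sq_le s hw (fun i => sq_nonneg (u i)) (fun i => sq_nonneg (v i))
  simp only [Real.sqrt_sq (hu _), Real.sqrt_sq (hv _)] at h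
  refine h.trans ?_
  have h1 : √(∑ i ∈ s, w i * u i ^ 2) + √(∑ i ∈ s, w i * v i ^ 2) ≤ √A + √C * √B := by
    rw [← Real.sqrt_mul hC]
    gcongr
  refine (pow_le_pow_left₀ (by positivity) h1 2).trans ?_
  have hA' := Real.sq_sqrt hA
  have hB' := Real.sq_sqrt hB
  have hC' := Real.sq_sqrt hC
  rw [← hA', ← hB', ← hC']
  simp only [Real.sqrt_sq (Real.sqrt_nonneg _)]
  nlinarith [sq_nonneg (√C * √A - √B)]

/-- The weak transport-entropy inequality for a product, where the fibres over `i` and `j` are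
compared through a permutation `σ i j`. -/
lemma WeakTransportEntropy.prod [Nonempty I] [Nonempty Y] {d : I × Y → I × Y → ℝ}
    {d' : Y → Y → ℝ} {C : ℝ} (hC : 0 ≤ C) (σ : I → I → Equiv.Perm Y) (hd0 : ∀ z z', 0 ≤ d z z')
    (hd0' : ∀ y z, 0 ≤ d' y z)
    (hd : ∀ i j y z, d (i, y) (j, z) ≤ (if i = j then 0 else 1) + d' y (σ i j z))
    (h : WeakTransportEntropy Set.univ d' C) :
    WeakTransportEntropy Set.univ d (C + 1) := by
  rintro w₁ w₂ ⟨hw₁, -, s₁⟩ ⟨hw₂, -, s₂⟩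
  obtain ⟨ν₁, c₁, n₁, t₁, m₁, r₁, rfl⟩ := exists_disintegration hw₁
  obtain ⟨ν₂, c₂, n₂, t₂, m₂, r₂, rfl⟩ := exists_disintegration hw₂
  rw [s₁] at t₁
  rw [s₂] at t₂
  clear s₁ s₂ hw₁ hw₂
  obtain ⟨p, p0, p1, pm, pc⟩ := weakTransportEntropy_trivial ν₁ ν₂
    ⟨n₁, fun x hx => absurd (Set.mem_univ x) hx, t₁⟩
    ⟨n₂, fun x hx => absurd (Set.mem_univ x) hx, t₂⟩
  have hσ : ∀ i j, IsProbOn (fun y => c₂ j ((σ i j).symm y)) Set.univ := fun i j =>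
    ⟨fun y => m₂ _ _, fun x hx => absurd (Set.mem_univ x) hx,
      (Equiv.sum_comp (σ i j).symm (c₂ j)).trans (r₂ j)⟩
  have hq := fun i j => h (c₁ i) (fun y => c₂ j ((σ i j).symm y))
    ⟨m₁ i, fun x hx => absurd (Set.mem_univ x) hx, r₁ i⟩ (hσ i j)
  simp only [unifEnt_comp_equiv] at hq
  choose q q0 q1 qm qc using hq
  simp only [Set.ncard_univ, Nat.card_eq_fintype_card, mul_one] at pc qc ⊢
  rw [unifEnt_prod t₁ r₁, unifEnt_prod t₂ r₂]
  have E₁ := fun i => unifEnt_card_nonneg (m₁ i) (r₁ i)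
  have E₂ := fun i => unifEnt_card_nonneg (m₂ i) (r₂ i)
  have F₁ := unifEnt_card_nonneg n₁ t₁
  have F₂ := unifEnt_card_nonneg n₂ t₂
  have G₁ : 0 ≤ ∑ i, ν₁ i * unifEnt (Fintype.card Y) (c₁ i) :=
    Finset.sum_nonneg fun i _ => mul_nonneg (n₁ i) (E₁ i)
  have G₂ : 0 ≤ ∑ i, ν₂ i * unifEnt (Fintype.card Y) (c₂ i) :=
    Finset.sum_nonneg fun i _ => mul_nonneg (n₂ i) (E₂ i)
  refine ⟨fun z z' => p z.1 z'.1 * q z.1 z'.1 z.2 (σ z.1 z'.1 z'.2),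
    fun _ _ => mul_nonneg (p0 _ _) (q0 _ _ _ _), ?_, ?_, ?_⟩
  · rintro ⟨i, y⟩
    simp only [Fintype.sum_prod_type, ← Finset.mul_sum]
    simp only [fun j => Equiv.sum_comp (σ i j) (q i j y), q1, mul_one, p1]
  · rintro ⟨j, z⟩
    simp only [Fintype.sum_prod_type]
    have : ∀ i, ∑ y, ν₁ i * c₁ i y * (p i j * q i j y (σ i j z)) = ν₁ i * p i j * c₂ j z := by
      intro i
      have := qm i j (σ i j z)
      simp only [Equiv.symm_apply_apply] at this
      rw [← this, Finset.mul_sum]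
      exact Finset.sum_congr rfl fun y _ => by ring
    simp only [this, ← Finset.sum_mul, pm]
  · set u : I × Y → ℝ := fun z => ∑ j, p z.1 j * (if z.1 = j then 0 else 1) with hu
    set D : I → I → Y → ℝ := fun i j y => ∑ y', q i j y y' * d' y y' with hD
    set v : I × Y → ℝ := fun z => ∑ j, p z.1 j * D z.1 j z.2 with hv
    set A := 2 * (√(unifEnt (Fintype.card I) ν₁) + √(unifEnt (Fintype.card I) ν₂)) ^ 2 with hA
    set B := 2 * (√(∑ i, ν₁ i * unifEnt (Fintype.card Y) (c₁ i)) +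
      √(∑ i, ν₂ i * unifEnt (Fintype.card Y) (c₂ i))) ^ 2 with hB
    have D0 : ∀ i j y, 0 ≤ D i j y := fun i j y =>
      Finset.sum_nonneg fun y' _ => mul_nonneg (q0 _ _ _ _) (hd0' _ _)
    have u0 : ∀ z, 0 ≤ u z := fun z => Finset.sum_nonneg fun j _ =>
      mul_nonneg (p0 _ _) (by split_ifs <;> norm_num)
    have v0 : ∀ z, 0 ≤ v z := fun z => Finset.sum_nonneg fun j _ => mul_nonneg (p0 _ _) (D0 _ _ _)
    have huv : ∀ z, ∑ z', p z.1 z'.1 * q z.1 z'.1 z.2 (σ z.1 z'.1 z'.2) * d z z' ≤ u z + v z := by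
      rintro ⟨i, y⟩
      simp only [Fintype.sum_prod_type, hu, hv]
      rw [← Finset.sum_add_distrib]
      refine Finset.sum_le_sum fun j _ => ?_
      rw [← mul_add]
      simp only [mul_assoc, ← Finset.mul_sum]
      refine mul_le_mul_of_nonneg_left ?_ (p0 i j)
      calc _ ≤ ∑ z, q i j y (σ i j z) * ((if i = j then 0 else 1) + d' y (σ i j z)) :=
            Finset.sum_le_sum fun z _ => mul_le_mul_of_nonneg_left (hd i j y z) (q0 _ _ _ _)
        _ = ∑ z, q i j y z * ((if i = j then 0 else 1) + d' y z) :=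
            Equiv.sum_comp (σ i j) fun z => q i j y z * ((if i = j then 0 else 1) + d' y z)
        _ = _ := by
            simp only [mul_add, Finset.sum_add_distrib, ← Finset.sum_mul, q1, one_mul, hD]
    have hu2 : ∑ z : I × Y, ν₁ z.1 * c₁ z.1 z.2 * u z ^ 2 ≤ A := by
      refine le_trans (le_of_eq ?_) pc
      rw [Fintype.sum_prod_type]
      refine Finset.sum_congr rfl fun i _ => ?_
      have hui : ∀ y, u (i, y) = ∑ j, p i j * (if i = j then 0 else 1) := fun _ => rfl
      simp only [hui]
      rw [← Finset.sum_mul, ← Finset.mul_sum, r₁, mul_one]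
    have hv2 : ∑ z : I × Y, ν₁ z.1 * c₁ z.1 z.2 * v z ^ 2 ≤ C * B := by
      calc _ ≤ ∑ z : I × Y, ν₁ z.1 * c₁ z.1 z.2 * ∑ j, p z.1 j * D z.1 j z.2 ^ 2 :=
            Finset.sum_le_sum fun z _ => mul_le_mul_of_nonneg_left
              (sq_sum_mul_le _ (p0 z.1) (p1 z.1).le) (mul_nonneg (n₁ _) (m₁ _ _))
        _ = ∑ i, ∑ j, ν₁ i * p i j * ∑ y, c₁ i y * D i j y ^ 2 := by
            rw [Fintype.sum_prod_type]
            refine Finset.sum_congr rfl fun i _ => ?_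
            simp only [Finset.mul_sum]
            rw [Finset.sum_comm]
            exact Finset.sum_congr rfl fun j _ => Finset.sum_congr rfl fun y _ => by ring
        _ ≤ ∑ i, ∑ j, ν₁ i * p i j * (2 * C * (√(unifEnt (Fintype.card Y) (c₁ i)) +
              √(unifEnt (Fintype.card Y) (c₂ j))) ^ 2) :=
            Finset.sum_le_sum fun i _ => Finset.sum_le_sum fun j _ =>
              mul_le_mul_of_nonneg_left (qc i j) (mul_nonneg (n₁ i) (p0 i j))
        _ = 2 * C * ∑ x : I × I, ν₁ x.1 * p x.1 x.2 * (√(unifEnt (Fintype.card Y) (c₁ x.1)) +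
              √(unifEnt (Fintype.card Y) (c₂ x.2))) ^ 2 := by
            rw [Fintype.sum_prod_type]
            simp only [Finset.mul_sum]
            exact Finset.sum_congr rfl fun j _ => Finset.sum_congr rfl fun y _ => by ring
        _ ≤ 2 * C * _ := mul_le_mul_of_nonneg_left (sum_mul_sqrt_add_sqrt_sq_le _
            (fun x => mul_nonneg (n₁ _) (p0 _ _)) (fun x => E₁ _) (fun x => E₂ _)) (by positivity)
        _ = C * B := by
            have e₁ : ∑ x : I × I, ν₁ x.1 * p x.1 x.2 * unifEnt (Fintype.card Y) (c₁ x.1) =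
                ∑ i, ν₁ i * unifEnt (Fintype.card Y) (c₁ i) := by
              rw [Fintype.sum_prod_type]
              simp only [← Finset.sum_mul, ← Finset.mul_sum, p1, mul_one]
            have e₂ : ∑ x : I × I, ν₁ x.1 * p x.1 x.2 * unifEnt (Fintype.card Y) (c₂ x.2) =
                ∑ i, ν₂ i * unifEnt (Fintype.card Y) (c₂ i) := by
              rw [Fintype.sum_prod_type_right]
              simp only [← Finset.sum_mul, pm]
            rw [e₁, e₂, hB]
            ring
    have hw : ∀ z : I × Y, 0 ≤ ν₁ z.1 * c₁ z.1 z.2 := fun z => mul_nonneg (n₁ _) (m₁ _ _)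
    calc _ ≤ ∑ z : I × Y, ν₁ z.1 * c₁ z.1 z.2 * (u z + v z) ^ 2 :=
          Finset.sum_le_sum fun z _ => mul_le_mul_of_nonneg_left (pow_le_pow_left₀
            (Finset.sum_nonneg fun z' _ => mul_nonneg (mul_nonneg (p0 _ _) (q0 _ _ _ _))
              (hd0 _ _)) (huv z) 2) (hw z)
      _ ≤ (C + 1) * (A + B) := sum_mul_add_sq_le _ hw u0 v0 hC (by positivity) (by positivity)
          hu2 hv2
      _ ≤ _ := by
          have := mul_le_mul_of_nonneg_left (sqrt_add_sqrt_sq_add_le F₁ G₁ F₂ G₂)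
            (show 0 ≤ 2 * (C + 1) by positivity)
          rw [hA, hB]
          linarith

end Product

section Pushforward
variable {X Z : Type*} [Fintype X] [Fintype Z]

/-- The weak transport-entropy inequality passes to images under maps whose fibres over `S`
all have the same cardinality. -/
lemma WeakTransportEntropy.map {f : Z → X} {S : Set X} {m : ℕ} {d : X → X → ℝ} {dZ : Z → Z → ℝ}
    {C : ℝ} (hm : 0 < m) (hfS : ∀ z, f z ∈ S)
    (hcard : ∀ x ∈ S, (Finset.univ.filter fun z => f z = x).card = m)
    (hd0 : ∀ x y, 0 ≤ d x y) (hd : ∀ z z', d (f z) (f z') ≤ dZ z z')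
    (h : WeakTransportEntropy Set.univ dZ C) : WeakTransportEntropy S d C := by
  have hm' : (m : ℝ) ≠ 0 := by positivity
  have hfib : ∀ (x : X), x ∈ S → ∀ c : ℝ, ∑ z with f z = x, c = m * c := by
    intro x hx c
    rw [Finset.sum_const, hcard x hx, nsmul_eq_mul]
  have hlift : ∀ g : X → ℝ, (∀ x, x ∉ S → g x = 0) → ∑ z, g (f z) = m * ∑ x, g x := by
    intro g hg
    rw [← Finset.sum_fiberwise Finset.univ f, Finset.mul_sum]
    refine Finset.sum_congr rfl fun x _ => ?_
    by_cases hx : x ∈ S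
    · rw [← hfib x hx]
      exact Finset.sum_congr rfl fun z hz => by rw [(Finset.mem_filter.1 hz).2]
    · rw [hg x hx, mul_zero]
      exact Finset.sum_eq_zero fun z hz => by rw [(Finset.mem_filter.1 hz).2, hg x hx]
  have hcZ : (Fintype.card Z : ℝ) = m * S.ncard := by
    have := hlift (S.indicator 1) (by simp)
    simp [hfS] at this
    rw [this]
    simp [Set.indicator_apply, Set.ncard_eq_toFinset_card']
  have hprob : ∀ ν : X → ℝ, IsProbOn ν S → IsProbOn (fun z => ν (f z) / m) Set.univ := by
    rintro ν ⟨h0, h1, h2⟩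
    refine ⟨fun z => div_nonneg (h0 _) (by positivity), fun x hx => absurd (Set.mem_univ x) hx, ?_⟩
    rw [← Finset.sum_div, hlift ν h1, h2]
    field_simp
  have hent : ∀ ν : X → ℝ, IsProbOn ν S →
      unifEnt (Set.univ : Set Z).ncard (fun z => ν (f z) / m) = unifEnt S.ncard ν := by
    rintro ν ⟨h0, h1, h2⟩
    have hS : (S.ncard : ℝ) ≠ 0 := by
      have : S.Nonempty := by
        by_contra hne
        rw [Set.not_nonempty_iff_eq_empty] at hne
        simp [h1, hne] at h2
      exact_mod_cast ((Set.ncard_pos (Set.toFinite S)).2 this).ne'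
    have e : ∀ x, ν x / m * Real.log (ν x / m) =
        (ν x * Real.log (ν x) - ν x * Real.log m) / m := by
      intro x
      rcases eq_or_ne (ν x) 0 with hx | hx
      · simp [hx]
      · rw [Real.log_div hx hm']
        ring
    simp only [unifEnt, Set.ncard_univ, Nat.card_eq_fintype_card, hcZ, e]
    rw [← Finset.sum_div, hlift (fun x => ν x * Real.log (ν x) - ν x * Real.log m)
      (fun x hx => by simp [h1 x hx]), Finset.sum_sub_distrib, ← Finset.sum_mul, h2,
      Real.log_mul hm' hS]
    field_simp
    ring
  intro ν₁ ν₂ h₁ h₂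
  obtain ⟨q, q0, q1, qm, qc⟩ := h _ _ (hprob _ h₁) (hprob _ h₂)
  rw [hent _ h₁, hent _ h₂] at qc
  have hq : ∀ z (g : X → ℝ), ∑ y, (∑ z' with f z' = y, q z z') * g y = ∑ z', q z z' * g (f z') := by
    intro z g
    rw [← Finset.sum_fiberwise Finset.univ f]
    refine Finset.sum_congr rfl fun y _ => ?_
    rw [Finset.sum_mul]
    exact Finset.sum_congr rfl fun z' hz => by rw [(Finset.mem_filter.1 hz).2]
  have hmean : ∀ x ∈ S, ∀ g : X → ℝ,
      ∑ y, (∑ z with f z = x, ∑ z' with f z' = y, q z z') / m * g y =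
        ∑ z with f z = x, (m : ℝ)⁻¹ * ∑ z', q z z' * g (f z') := by
    intro x hx g
    simp only [← hq]
    simp only [Finset.mul_sum, Finset.sum_mul, Finset.sum_div]
    rw [Finset.sum_comm]
    exact Finset.sum_congr rfl fun z _ => Finset.sum_congr rfl fun y _ =>
      Finset.sum_congr rfl fun z' _ => by ring
  refine ⟨fun x y => if x ∈ S then (∑ z with f z = x, ∑ z' with f z' = y, q z z') / m
    else if x = y then 1 else 0, ?_, ?_, ?_, ?_⟩
  · intro x y
    dsimp only
    split_ifs
    · exact div_nonneg (Finset.sum_nonneg fun z _ => Finset.sum_nonneg fun z' _ => q0 _ _)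
        (by positivity)
    · exact zero_le_one
    · exact le_rfl
  · intro x
    by_cases hx : x ∈ S
    · have := hmean x hx (fun _ => 1)
      simp only [mul_one, q1] at this
      simp only [hx, if_true]
      rw [this, hfib x hx]
      field_simp
    · simp [hx]
  · intro y
    have e : ∀ x, ν₁ x * (if x ∈ S then (∑ z with f z = x, ∑ z' with f z' = y, q z z') / m
        else if x = y then 1 else 0) =
        ∑ z with f z = x, ∑ z' with f z' = y, ν₁ (f z) / m * q z z' := by
      intro x
      by_cases hx : x ∈ S
      · simp only [hx, if_true]
        rw [Finset.sum_div, Finset.mul_sum]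
        refine Finset.sum_congr rfl fun z hz => ?_
        rw [(Finset.mem_filter.1 hz).2, ← Finset.mul_sum]
        ring
      · rw [h₁.2.1 x hx, zero_mul, Finset.sum_eq_zero]
        intro z hz
        simp [(Finset.mem_filter.1 hz).2, h₁.2.1 x hx]
    simp only [e]
    rw [Finset.sum_fiberwise Finset.univ f fun z => ∑ z' with f z' = y, ν₁ (f z) / m * q z z',
      Finset.sum_comm]
    simp only [qm]
    by_cases hy : y ∈ S
    · rw [Finset.sum_congr rfl fun z hz => by rw [(Finset.mem_filter.1 hz).2], hfib y hy]
      field_simp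
    · rw [h₂.2.1 y hy]
      exact Finset.sum_eq_zero fun z hz => by rw [(Finset.mem_filter.1 hz).2, h₂.2.1 y hy, zero_div]
  · refine le_trans ?_ qc
    rw [← Finset.sum_fiberwise Finset.univ f]
    refine Finset.sum_le_sum fun x _ => ?_
    by_cases hx : x ∈ S
    · simp only [hx, if_true]
      rw [hmean x hx (d x)]
      calc _ ≤ ν₁ x * ∑ z with f z = x, (m : ℝ)⁻¹ * (∑ z', q z z' * d x (f z')) ^ 2 := by
            refine mul_le_mul_of_nonneg_left (sq_sum_mul_le _ (fun _ => by positivity) ?_) (h₁.1 x)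
            rw [hfib x hx, mul_inv_cancel₀ hm']
        _ = ∑ z with f z = x, ν₁ (f z) / m * (∑ z', q z z' * d (f z) (f z')) ^ 2 := by
            rw [Finset.mul_sum]
            refine Finset.sum_congr rfl fun z hz => ?_
            rw [(Finset.mem_filter.1 hz).2]
            ring
        _ ≤ _ := Finset.sum_le_sum fun z _ => mul_le_mul_of_nonneg_left (pow_le_pow_left₀
            (Finset.sum_nonneg fun z' _ => mul_nonneg (q0 _ _) (hd0 _ _))
            (Finset.sum_le_sum fun z' _ => mul_le_mul_of_nonneg_left (hd _ _) (q0 _ _)) 2)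
            (div_nonneg (h₁.1 _) (by positivity))
    · rw [h₁.2.1 x hx, zero_mul]
      exact Finset.sum_nonneg fun z _ => mul_nonneg (div_nonneg (h₁.1 _) (by positivity))
        (sq_nonneg _)

end Pushforward

section Perm
open Equiv Equiv.Perm

/-- The number of points among the first `k` which `σ` sends outside the image under `τ` of
the first `k` points. -/
def initialDefect {n : ℕ} (k : ℕ) (σ τ : Perm (Fin n)) : ℝ :=
  (Finset.univ.filter fun l => l.val < k ∧ ¬ (τ⁻¹ (σ l)).val < k).card

lemma initialDefect_le_swap_mul_add_one {n : ℕ} (k : ℕ) (σ τ : Perm (Fin n)) (i j : Fin n) :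
    initialDefect k σ τ ≤ initialDefect k σ (swap i j * τ) + 1 := by
  have hsub : (Finset.univ.filter fun l => l.val < k ∧ ¬ (τ⁻¹ (σ l)).val < k) ⊆
      (Finset.univ.filter fun l => l.val < k ∧ ¬ ((swap i j * τ)⁻¹ (σ l)).val < k) ∪
      (Finset.univ.filter fun l => ¬ (τ⁻¹ (σ l)).val < k ∧ ((swap i j * τ)⁻¹ (σ l)).val < k) := by
    intro l
    simp only [Finset.mem_union, Finset.mem_filter, Finset.mem_univ, true_and]
    tauto
  have hone : (Finset.univ.filter fun l =>
      ¬ (τ⁻¹ (σ l)).val < k ∧ ((swap i j * τ)⁻¹ (σ l)).val < k).card ≤ 1 := by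
    rw [Finset.card_le_one]
    intro a ha b hb
    simp only [Finset.mem_filter, Finset.mem_univ, true_and, mul_inv_rev, swap_inv,
      Perm.mul_apply] at ha hb
    have key : ∀ l, ¬ (τ⁻¹ (σ l)).val < k ∧ (τ⁻¹ (swap i j (σ l))).val < k →
        σ l = i ∧ ¬ (τ⁻¹ i).val < k ∧ (τ⁻¹ j).val < k ∨
        σ l = j ∧ ¬ (τ⁻¹ j).val < k ∧ (τ⁻¹ i).val < k := by
      rintro l ⟨h1, h2⟩
      by_cases hi : σ l = i
      · rw [hi, swap_apply_left] at h2
        rw [hi] at h1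
        exact Or.inl ⟨hi, h1, h2⟩
      by_cases hj : σ l = j
      · rw [hj, swap_apply_right] at h2
        rw [hj] at h1
        exact Or.inr ⟨hj, h1, h2⟩
      · rw [swap_apply_of_ne_of_ne hi hj] at h2
        exact absurd h2 h1
    apply σ.injective
    rcases key a ha with ⟨h1, h2, h3⟩ | ⟨h1, h2, h3⟩ <;>
    rcases key b hb with ⟨h4, h5, h6⟩ | ⟨h4, h5, h6⟩ <;> first
      | exact h1.trans h4.symm
      | contradiction
  unfold initialDefect
  exact_mod_cast (Finset.card_le_card hsub).trans ((Finset.card_union_le _ _).trans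
    (Nat.add_le_add_left hone _))

lemma initialDefect_decomposeFin {m : ℕ} (k : ℕ) (i : Fin (m + 1)) (σ τ : Perm (Fin m)) :
    initialDefect (k + 1) (decomposeFin.symm (i, σ)) (decomposeFin.symm (i, τ)) =
      initialDefect k σ τ := by
  have h0 : (decomposeFin.symm (i, τ))⁻¹ (decomposeFin.symm (i, σ) 0) = 0 := by
    rw [Perm.inv_eq_iff_eq]
    simp
  have hs : ∀ l : Fin m, (decomposeFin.symm (i, τ))⁻¹ (decomposeFin.symm (i, σ) l.succ) =
      (τ⁻¹ (σ l)).succ := by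
    intro l
    rw [Perm.inv_eq_iff_eq]
    simp
  unfold initialDefect
  rw [Finset.card_filter, Fin.sum_univ_succ, Finset.card_filter]
  simp only [h0, hs, Fin.val_zero, Fin.val_succ]
  simp

lemma exists_swap_mul_decomposeFin {m : ℕ} (i j : Fin (m + 1)) :
    ∃ g : Perm (Fin m), ∀ τ, swap i j * decomposeFin.symm (j, τ) =
      decomposeFin.symm (i, g * τ) := by
  have hmul : ∀ (p : Fin (m + 1)) (a b : Perm (Fin m)),
      decomposeFin.symm (p, a * b) = decomposeFin.symm (p, a) * decomposeFin.symm (0, b) := by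
    intro p a b
    ext x
    refine Fin.cases ?_ (fun y => ?_) x <;> simp
  obtain ⟨⟨p, g⟩, hg⟩ := decomposeFin.symm.surjective (swap i j * decomposeFin.symm (j, 1))
  have hp : p = i := by
    have := congrArg (fun s => s 0) hg
    simpa using this
  subst hp
  refine ⟨g, fun τ => ?_⟩
  rw [hmul, hg, mul_assoc, ← hmul, one_mul]

lemma weakTransportEntropy_zero {X : Type*} [Fintype X] {d : X → X → ℝ} {C : ℝ} (hC : 0 ≤ C)
    (hd : ∀ x y, d x y = 0) : WeakTransportEntropy Set.univ d C := by
  rintro ν₁ ν₂ ⟨-, -, s₁⟩ ⟨n₂, -, s₂⟩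
  refine ⟨fun _ y => ν₂ y, fun _ y => n₂ y, fun _ => s₂, fun y => ?_, ?_⟩
  · rw [← Finset.sum_mul, s₁, one_mul]
  · simp only [hd, mul_zero, Finset.sum_const_zero, zero_pow two_ne_zero]
    positivity

lemma initialDefect_nonneg {n : ℕ} (k : ℕ) (σ τ : Perm (Fin n)) : 0 ≤ initialDefect k σ τ :=
  Nat.cast_nonneg _

/-- The weak transport-entropy inequality on the symmetric group. -/
lemma weakTransportEntropy_perm (n k : ℕ) :
    WeakTransportEntropy (Set.univ : Set (Perm (Fin n))) (initialDefect k) k := by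
  induction k generalizing n with
  | zero => exact weakTransportEntropy_zero (Nat.cast_nonneg _) (by simp [initialDefect])
  | succ k ih =>
    cases n with
    | zero => exact weakTransportEntropy_zero (Nat.cast_nonneg _) (by simp [initialDefect])
    | succ m =>
      choose g hg using exists_swap_mul_decomposeFin (m := m)
      push_cast
      refine WeakTransportEntropy.map (f := decomposeFin.symm) (m := 1) one_pos
        (fun _ => Set.mem_univ _) ?_ (initialDefect_nonneg _) (fun _ _ => le_rfl)
        ((ih m).prod (Nat.cast_nonneg k) (fun i j => Equiv.mulLeft (g i j))
          (fun _ _ => initialDefect_nonneg _ _ _) (initialDefect_nonneg k) ?_)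
      · intro σ _
        rw [Finset.card_eq_one]
        refine ⟨decomposeFin σ, ?_⟩
        ext z
        simp [Equiv.symm_apply_eq]
      · intro i j σ τ
        rw [Equiv.coe_mulLeft]
        by_cases hij : i = j
        · subst hij
          have h1 := hg i i τ
          rw [swap_self] at h1
          have h2 := congrArg Prod.snd (decomposeFin.symm.injective h1)
          simp only at h2
          simp only [← h2, initialDefect_decomposeFin, if_true, zero_add, le_refl]
        · have h1 := initialDefect_le_swap_mul_add_one (k + 1) (decomposeFin.symm (i, σ))
            (decomposeFin.symm (j, τ)) i j
          rw [hg, initialDefect_decomposeFin] at h1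
          simp only [hij, if_false]
          linarith

end Perm

section Slice
variable {n k : ℕ}

lemma ncard_cubeSlice : (cubeSlice n k).ncard = n.choose k := by
  have hS : cubeSlice n k = (Finset.univ.filter fun x : Fin n → Bool =>
      (Finset.univ.filter fun i => x i = true).card = k : Finset (Fin n → Bool)) := by
    ext
    simp [cubeSlice]
  rw [hS, Set.ncard_coe_finset, ← Fintype.card_fin n, ← Finset.card_univ (α := Fin n),
    ← Finset.card_powersetCard, Finset.card_univ, Fintype.card_fin]
  refine Finset.card_nbij' (fun x => Finset.univ.filter fun i => x i = true)
    (fun s i => decide (i ∈ s)) ?_ ?_ ?_ ?_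
  · intro x hx
    simpa [Finset.mem_powersetCard] using hx
  · intro s hs
    simpa [Finset.mem_powersetCard] using hs
  · intro x _
    ext i
    simp
  · intro s _
    ext i
    simp

lemma card_filter_eq_of_mem_cubeSlice {x y : Fin n → Bool} (hx : x ∈ cubeSlice n k)
    (hy : y ∈ cubeSlice n k) (c : Bool) :
    (Finset.univ.filter fun i => x i = c).card = (Finset.univ.filter fun i => y i = c).card := by
  have h : (Finset.univ.filter fun i => x i = true).card =
      (Finset.univ.filter fun i => y i = true).card := Eq.trans hx (Eq.symm hy)
  cases c
  · have hx' := Finset.card_filter_add_card_filter_not (s := Finset.univ) (fun i => x i = true)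
    have hy' := Finset.card_filter_add_card_filter_not (s := Finset.univ) (fun i => y i = true)
    simp only [Bool.not_eq_true] at hx' hy'
    omega
  · exact h

lemma dh_eq_card_of_mem_cubeSlice {x y : Fin n → Bool} (hx : x ∈ cubeSlice n k)
    (hy : y ∈ cubeSlice n k) (c : Bool) :
    dh x y = (Finset.univ.filter fun i => x i = c ∧ ¬ y i = c).card := by
  have hcomm := Finset.card_sdiff_comm (card_filter_eq_of_mem_cubeSlice hx hy c)
  have e : ∀ u v : Fin n → Bool, (Finset.univ.filter fun i => u i = c) \
      (Finset.univ.filter fun i => v i = c) =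
      Finset.univ.filter fun i => u i = c ∧ ¬ v i = c := by
    intro u v
    ext i
    simp
  rw [e, e] at hcomm
  have hsplit : (Finset.univ.filter fun i => x i ≠ y i) =
      (Finset.univ.filter fun i => x i = c ∧ ¬ y i = c) ∪
        (Finset.univ.filter fun i => y i = c ∧ ¬ x i = c) := by
    ext i
    simp only [Finset.mem_filter, Finset.mem_univ, true_and, Finset.mem_union]
    cases x i <;> cases y i <;> cases c <;> simp
  rw [dh, hsplit, Finset.card_union_of_disjoint, ← hcomm]
  · push_cast
    ring
  · rw [Finset.disjoint_filter]
    tauto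

lemma exists_perm_of_mem_cubeSlice {x y : Fin n → Bool} (hx : x ∈ cubeSlice n k)
    (hy : y ∈ cubeSlice n k) : ∃ g : Equiv.Perm (Fin n), ∀ i, y (g i) = x i := by
  have hcard : Fintype.card {i // x i = true} = Fintype.card {i // y i = true} := by
    rw [Fintype.card_subtype, Fintype.card_subtype]
    exact card_filter_eq_of_mem_cubeSlice hx hy true
  refine ⟨(Fintype.equivOfCardEq hcard).extendSubtype, fun i => ?_⟩
  by_cases h : x i = true
  · rw [h]
    exact Equiv.extendSubtype_mem (Fintype.equivOfCardEq hcard) i h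
  · have := Equiv.extendSubtype_not_mem (Fintype.equivOfCardEq hcard) i h
    rw [Bool.not_eq_true] at h this
    rw [h, this]

lemma comp_perm_mem_cubeSlice {x : Fin n → Bool} (hx : x ∈ cubeSlice n k)
    (σ : Equiv.Perm (Fin n)) : (fun i => x (σ i)) ∈ cubeSlice n k := by
  refine Eq.trans ?_ hx
  exact Finset.card_equiv σ (by simp)

lemma exists_initial_mem_cubeSlice (hk : k ≤ n) :
    ∃ x ∈ cubeSlice n k, ∃ c : Bool, ∀ l : Fin n, x l = c ↔ l.val < min k (n - k) := by
  rcases le_total k (n - k) with h | h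
  · refine ⟨fun l => decide (l.val < k), ?_, true, fun l => by simp [min_eq_left h]⟩
    simp [cubeSlice, Fin.card_filter_val_lt, hk]
  · refine ⟨fun l => !decide (l.val < n - k), ?_, false, fun l => by simp [min_eq_right h]⟩
    have := Finset.card_filter_add_card_filter_not (s := Finset.univ)
      (fun l : Fin n => l.val < n - k)
    rw [Fin.card_filter_val_lt, Finset.card_univ, Fintype.card_fin] at this
    simp only [cubeSlice, Set.mem_ofPred_eq, Bool.not_eq_true', decide_eq_false_iff_not]
    omega

/-- The weak transport-entropy inequality on the slice, in real-valued form. -/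
lemma weakTransportEntropy_cubeSlice (hk : k ≤ n) :
    WeakTransportEntropy (cubeSlice n k) dh ((min k (n - k) : ℕ) : ℝ) := by
  obtain ⟨x₀, hx₀, c, hc⟩ := exists_initial_mem_cubeSlice hk
  refine WeakTransportEntropy.map
    (f := fun (σ : Equiv.Perm (Fin n)) i => x₀ (σ⁻¹ i))
    (m := (Finset.univ.filter fun σ : Equiv.Perm (Fin n) => (fun i => x₀ (σ⁻¹ i)) = x₀).card)
    (Finset.card_pos.2 ⟨1, by simp [← Equiv.Perm.inv_def]⟩)
    (fun σ => comp_perm_mem_cubeSlice hx₀ σ⁻¹) ?_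
    (fun x y => by unfold dh; positivity) ?_ (weakTransportEntropy_perm n (min k (n - k)))
  · intro x hx
    obtain ⟨g, hg⟩ := exists_perm_of_mem_cubeSlice hx₀ hx
    refine (Finset.card_equiv (Equiv.mulLeft g) fun σ => ?_).symm
    simp only [Finset.mem_filter, Finset.mem_univ, true_and, Equiv.coe_mulLeft, mul_inv_rev,
      Equiv.Perm.mul_apply, funext_iff]
    constructor
    · intro h i
      rw [h, ← hg, Equiv.Perm.inv_def, Equiv.apply_symm_apply]
    · intro h i
      have := h (g i)
      rwa [hg, Equiv.Perm.inv_def g, Equiv.symm_apply_apply] at this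
  · intro σ τ
    rw [dh_eq_card_of_mem_cubeSlice (comp_perm_mem_cubeSlice hx₀ σ⁻¹)
      (comp_perm_mem_cubeSlice hx₀ τ⁻¹) c, initialDefect]
    refine le_of_eq (congrArg _ (Finset.card_equiv σ⁻¹ fun i => ?_))
    simp only [Finset.mem_filter, Finset.mem_univ, true_and, hc, Equiv.Perm.inv_def,
      Equiv.apply_symm_apply]

lemma relEnt_unifSlice {ν : (Fin n → Bool) → ℝ} (hν : IsProbOn ν (cubeSlice n k)) (hk : k ≤ n) :
    relEnt ν (unifSlice n k) = ENNReal.ofReal (unifEnt (cubeSlice n k).ncard ν) := by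
  obtain ⟨-, h1, h2⟩ := hν
  have hN : (n.choose k : ℝ) ≠ 0 := by exact_mod_cast (Nat.choose_pos hk).ne'
  rw [relEnt, if_pos, ncard_cubeSlice, unifEnt]
  · congr 1
    rw [← one_mul (Real.log (n.choose k)), ← h2, Finset.sum_mul, ← Finset.sum_add_distrib]
    refine Finset.sum_congr rfl fun x _ => ?_
    rcases eq_or_ne (ν x) 0 with h0 | h0
    · simp [h0]
    · have hx : x ∈ cubeSlice n k := by
        by_contra hx
        exact h0 (h1 x hx)
      rw [unifSlice, if_pos hx, div_inv_eq_mul, Real.log_mul h0 hN]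
      ring
  · intro x hx
    refine h1 x fun hmem => ?_
    rw [unifSlice, if_pos hmem] at hx
    exact inv_ne_zero hN hx

end Slice

lemma ENNReal.ofReal_rpow_half (a : ℝ) :
    ENNReal.ofReal a ^ ((1 : ℝ) / 2) = ENNReal.ofReal (√a) := by
  rcases le_total 0 a with h | h
  · rw [ENNReal.ofReal_rpow_of_nonneg h (by norm_num), Real.sqrt_eq_rpow]
  · rw [ENNReal.ofReal_of_nonpos h, Real.sqrt_eq_zero_of_nonpos h, ENNReal.ofReal_zero]
    exact ENNReal.zero_rpow_of_pos (by norm_num)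

lemma HasTransport.tT2_le {X : Type*} [Fintype X] {d : X → X → ℝ} {ν₁ ν₂ : X → ℝ} {c : ℝ}
    (hν : ∀ x, 0 ≤ ν₁ x) (h : HasTransport d ν₁ ν₂ c) : tT2 d ν₁ ν₂ ≤ c := by
  obtain ⟨p, h0, h1, hm, hc⟩ := h
  refine le_trans (csInf_le ⟨0, ?_⟩ ⟨p, h0, h1, hm, rfl⟩) hc
  rintro _ ⟨q, -, -, -, rfl⟩
  exact Finset.sum_nonneg fun x _ => mul_nonneg (hν x) (sq_nonneg _)

/-- Transport-entropy inequality for the weak cost `̃T₂` on the cubeSlice of the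
discrete cube. -/
theorem stmt11 {n k : ℕ} (hn : 1 ≤ n) (hk : k ≤ n)
    (ν₁ ν₂ : (Fin n → Bool) → ℝ)
    (hν₁ : IsProbOn ν₁ (cubeSlice n k)) (hν₂ : IsProbOn ν₂ (cubeSlice n k)) :
    ENNReal.ofReal (tT2 dh ν₁ ν₂) ≤
      ENNReal.ofReal (2 * ((min k (n - k) : ℕ) : ℝ)) *
        (relEnt ν₁ (unifSlice n k) ^ ((1 : ℝ) / 2) +
          relEnt ν₂ (unifSlice n k) ^ ((1 : ℝ) / 2)) ^ 2 := by
  rw [relEnt_unifSlice hν₁ hk, relEnt_unifSlice hν₂ hk, ENNReal.ofReal_rpow_half,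
    ENNReal.ofReal_rpow_half, ← ENNReal.ofReal_add (Real.sqrt_nonneg _) (Real.sqrt_nonneg _),
    ← ENNReal.ofReal_pow (by positivity), ← ENNReal.ofReal_mul (by positivity)]
  exact ENNReal.ofReal_le_ofReal
    ((weakTransportEntropy_cubeSlice hk ν₁ ν₂ hν₁ hν₂).tT2_le hν₁.1)

end
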